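/- arXiv:2112.14365 — 2 statements merged into one kernel-verified Lean document; each statement's English description precedes it below -/
import Mathlib

section
/- Let b ≥ 2 and n ≥ 2 be integers, and assume there exists u ∈ ℕ with F(u) = n, so that K(n) is defined. (i) K(n) = b^{B(n)} + 1 + k for some integer k with 0 ≤ k ≤ (b−1)·B(n) − 2, where B(n) := ⌊log_b K(n)⌋ ≥ 1; in particular the leading base-b digit of K(n) equals 1. (ii) If b is odd, then both K(n) and k are even. -/
namespace Kaprekar

/-- Sum of the digits of `v` in base `b`. -/
def s (b v : ℕ) : ℕ := (Nat.digits b v).sum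

/-- `f v = v + s v`. -/
def f (b v : ℕ) : ℕ := v + s b v

/-- `F u` is the number of generators of `u`. -/
noncomputable def F (b u : ℕ) : ℕ := Set.ncard {v : ℕ | f b v = u}

/-- `K n` is the least `u` with exactly `n` generators. -/
noncomputable def K (b n : ℕ) : ℕ := sInf {u : ℕ | F b u = n}

/-- `B n = ⌊log_b K(n)⌋`. -/
noncomputable def B (b n : ℕ) : ℕ := Nat.log b (K b n)

lemma s_of_lt {b x : ℕ} (hx : x < b) : s b x = x := by
  rcases Nat.eq_zero_or_pos x with rfl | h
  · simp [s]
  · simp [s, Nat.digits_of_lt b x h.ne' hx]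

lemma s_add_mul {b x : ℕ} (hb : 2 ≤ b) (hx : x < b) (y : ℕ) : s b (x + b * y) = x + s b y := by
  by_cases h : x = 0 ∧ y = 0
  · simp [s, h.1, h.2]
  · have h' : x ≠ 0 ∨ y ≠ 0 := by tauto
    simp [s, Nat.digits_add b (by omega) x y hx h']

lemma s_mul_pow_add {b c : ℕ} (hb : 2 ≤ b) (m : ℕ) :
    ∀ w, c * b ^ m + w < b ^ (m + 1) → s b (c * b ^ m + w) = c + s b w := by
  induction m with
  | zero =>
    intro w hw
    have hw' : c + w < b := by simpa using hw
    rw [pow_zero, mul_one, s_of_lt hw', s_of_lt (by omega)]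
  | succ m ih =>
    intro w hw
    have hx : w % b < b := Nat.mod_lt _ (by omega)
    have hdiv := Nat.mod_add_div w b
    have hsplit : c * b ^ (m + 1) + w = w % b + b * (c * b ^ m + w / b) := by
      rw [pow_succ]; nlinarith
    have hlt : c * b ^ m + w / b < b ^ (m + 1) := by
      refine Nat.lt_of_mul_lt_mul_left (a := b) ?_
      have : b * b ^ (m + 1) = b ^ (m + 1 + 1) := by ring
      omega
    have hw2 : s b w = w % b + s b (w / b) := by
      rw [← s_add_mul hb hx, hdiv]
    rw [hsplit, s_add_mul hb hx, ih _ hlt, hw2]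
    ring

lemma s_add_s_of_add_eq {b d : ℕ} (hb : 2 ≤ b) (hd : d < b) (m : ℕ) :
    ∀ v w, v + w + 1 = d * b ^ m → s b v + s b w + 1 = d + m * (b - 1) := by
  induction m with
  | zero =>
    intro v w h
    rw [pow_zero, mul_one] at h
    rw [s_of_lt (by omega), s_of_lt (by omega)]
    omega
  | succ m ih =>
    intro v w h
    have hx : v % b < b := Nat.mod_lt _ (by omega)
    have hy : w % b < b := Nat.mod_lt _ (by omega)
    have hv := Nat.mod_add_div v b
    have hw := Nat.mod_add_div w b
    have hsum : (v % b + w % b + 1) + b * (v / b + w / b) = b * (d * b ^ m) := by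
      rw [pow_succ] at h; nlinarith
    have hdvd : b ∣ v % b + w % b + 1 :=
      (Nat.dvd_add_left (Dvd.intro _ rfl)).1 (hsum ▸ Dvd.intro _ rfl)
    obtain ⟨q, hq⟩ := hdvd
    have hq1 : q = 1 := by
      have h1 : 0 < q := by
        rcases Nat.eq_zero_or_pos q with rfl | h'
        · omega
        · exact h'
      have h2 : q < 2 := by
        refine Nat.lt_of_mul_lt_mul_left (a := b) ?_
        omega
      omega
    rw [hq1, mul_one] at hq
    have hrec : v / b + w / b + 1 = d * b ^ m := by
      refine Nat.eq_of_mul_eq_mul_left (show 0 < b by omega) ?_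
      rw [← hsum, hq]; ring
    have := ih _ _ hrec
    rw [← hv, ← hw, s_add_mul hb hx, s_add_mul hb hy, add_mul]
    omega

lemma f_add_f_of_add_eq {b d m v w : ℕ} (hb : 2 ≤ b) (hd : d < b) (h : v + w + 1 = d * b ^ m) :
    f b v + f b w + 2 = d * b ^ m + d + m * (b - 1) := by
  have := s_add_s_of_add_eq hb hd m v w h
  unfold f
  omega

lemma le_of_f_eq {b u v : ℕ} (h : f b v = u) : v ≤ u := h ▸ Nat.le_add_right _ _

lemma f_add_two_le {b d m v : ℕ} (hb : 2 ≤ b) (hd : d < b) (h : v < d * b ^ m) :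
    f b v + 2 ≤ d * b ^ m + d + m * (b - 1) := by
  have := f_add_f_of_add_eq (m := m) (v := v) (w := d * b ^ m - 1 - v) hb hd
      (by omega)
  omega

lemma mul_pred_lt_pow {b : ℕ} (hb : 2 ≤ b) (m : ℕ) : m * (b - 1) < b ^ m := by
  obtain ⟨c, rfl⟩ := Nat.exists_eq_add_of_le' (show 1 ≤ b by omega)
  have := one_add_mul_le_pow (show (-2 : ℤ) ≤ c by omega) m
  rw [Nat.add_sub_cancel]
  zify
  rw [add_comm (c : ℤ)]
  linarith

lemma F_reflect {b d m u u' : ℕ} (hb : 2 ≤ b) (hd : d < b)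
    (hu : ∀ v, f b v = u → v < d * b ^ m) (hu' : ∀ v, f b v = u' → v < d * b ^ m)
    (h : u + u' + 2 = d * b ^ m + d + m * (b - 1)) : F b u = F b u' := by
  refine Set.ncard_congr (fun v _ => d * b ^ m - 1 - v) ?_ ?_ ?_
  · intro v hv
    have hlt := hu v hv
    have hf := f_add_f_of_add_eq (m := m) (v := v) (w := d * b ^ m - 1 - v) hb hd
      (by omega)
    simp only [Set.mem_ofPred_eq] at hv ⊢
    omega
  · intro v w hv hw hvw
    have := hu v hv
    have := hu w hw
    omega
  · intro w hw
    have hlt := hu' w hw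
    have hf := f_add_f_of_add_eq (m := m) (v := w) (w := d * b ^ m - 1 - w) hb hd
      (by omega)
    simp only [Set.mem_ofPred_eq] at hw
    exact ⟨d * b ^ m - 1 - w, by simp only [Set.mem_ofPred_eq]; omega, by omega⟩

lemma F_shift {b c m u : ℕ} (hb : 2 ≤ b) (hlt : u + c * (b ^ m + 1) < b ^ (m + 1))
    (hge : ∀ v, f b v = u + c * (b ^ m + 1) → c * b ^ m ≤ v) :
    F b u = F b (u + c * (b ^ m + 1)) := by
  rw [mul_add, mul_one] at *
  refine Set.ncard_congr (fun w _ => c * b ^ m + w) ?_ ?_ ?_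
  · intro w hw
    have hle := le_of_f_eq hw
    have hs := s_mul_pow_add hb m w (by omega : c * b ^ m + w < b ^ (m + 1))
    simp only [Set.mem_ofPred_eq, f] at hw ⊢
    omega
  · intro v w _ _ hvw
    simpa using hvw
  · intro v hv
    have hle := le_of_f_eq hv
    obtain ⟨w, rfl⟩ := Nat.exists_eq_add_of_le (hge v hv)
    have hs := s_mul_pow_add hb m w (by omega : c * b ^ m + w < b ^ (m + 1))
    refine ⟨w, ?_, rfl⟩
    simp only [Set.mem_ofPred_eq, f] at hv ⊢
    omega

lemma exists_f_eq_of_F_pos {b u : ℕ} (h : 0 < F b u) : ∃ v, f b v = u :=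
  Set.nonempty_of_ncard_ne_zero h.ne'

lemma even_f {b : ℕ} (hb : Odd b) (v : ℕ) : Even (f b v) := by
  have h : v ≡ s b v [MOD 2] := Nat.modEq_digits_sum 2 b (Nat.odd_iff.1 hb) v
  rw [Nat.even_iff, f]
  unfold Nat.ModEq at h
  omega

/-- A number `u = d * b ^ m + r` with a generator, such that no smaller number has as many
generators, has leading digit `1`, a nonzero remainder `r`, and a generator below `b ^ m`. -/
lemma leading_digit_eq_one {b d m r : ℕ} (hb : 2 ≤ b) (hd0 : 0 < d) (hd : d < b) (hr : r < b ^ m)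
    (hpos : 0 < F b (d * b ^ m + r))
    (hmin : ∀ u < d * b ^ m + r, F b u ≠ F b (d * b ^ m + r)) :
    d = 1 ∧ 1 ≤ r ∧ r + 1 ≤ m * (b - 1) := by
  have hbern := mul_pred_lt_pow hb m
  have hpow : b ^ m ≤ d * b ^ m := Nat.le_mul_of_pos_left _ hd0
  have hlt : d * b ^ m + r < b ^ (m + 1) := by
    have : (d + 1) * b ^ m ≤ b * b ^ m := Nat.mul_le_mul_right _ hd
    rw [pow_succ']
    linarith
  have hdr : d ≤ r := by
    by_contra! hrd
    have hu : ∀ v, f b v = d * b ^ m + r → v < d * b ^ m := by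
      intro v hv
      by_contra! hle
      obtain ⟨w, rfl⟩ := Nat.exists_eq_add_of_le hle
      have := s_mul_pow_add hb m w ((le_of_f_eq hv).trans_lt hlt)
      unfold f at hv
      omega
    obtain ⟨v, hv⟩ := exists_f_eq_of_F_pos hpos
    have := f_add_two_le hb hd (hu v hv)
    have hdm : d + b ^ m ≤ d * b ^ m + 1 := by
      have : 0 < b ^ m := by positivity
      nlinarith
    refine hmin (d + m * (b - 1) - 2 - r) (by omega) (F_reflect hb hd hu ?_ (by omega)).symm
    intro w hw
    have := le_of_f_eq hw
    omega
  have hd1 : d = 1 := by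
    by_contra! hne
    obtain ⟨c, rfl⟩ : ∃ c, d = c + 1 := ⟨d - 1, by omega⟩
    have hexp : (c + 1) * b ^ m = c * b ^ m + b ^ m := by ring
    have hu : (b ^ m + r - c) + c * (b ^ m + 1) = (c + 1) * b ^ m + r := by
      rw [mul_add, mul_one]
      omega
    refine hmin (b ^ m + r - c) (by rw [← hu, mul_add, mul_one]; omega) ?_
    rw [← hu]
    refine F_shift hb (by omega) ?_
    intro v hv
    by_contra! h
    have := f_add_two_le hb (by omega) h
    omega
  subst hd1
  refine ⟨rfl, hdr, ?_⟩
  by_contra! hrm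
  have hu : (r - 1) + 1 * (b ^ m + 1) = 1 * b ^ m + r := by omega
  refine hmin (r - 1) (by omega) ?_
  rw [← hu]
  refine F_shift hb (by omega) ?_
  intro v hv
  by_contra! h
  have := f_add_two_le hb hd h
  omega

theorem stmt8 (b n : ℕ) (hb : 2 ≤ b) (hn : 2 ≤ n) (hex : ∃ u : ℕ, F b u = n) :
    1 ≤ B b n ∧ K b n / b ^ B b n = 1 ∧
    ∃ k : ℕ, K b n = b ^ B b n + 1 + k ∧
      (k : ℤ) ≤ ((b : ℤ) - 1) * B b n - 2 ∧
      (Odd b → Even (K b n) ∧ Even k) := by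
  have hK : F b (K b n) = n := Nat.sInf_mem hex
  have hmin : ∀ u < K b n, F b u ≠ n := fun u hu =>
    Nat.notMem_of_lt_sInf (s := {u | F b u = n}) hu
  have hpos : 0 < F b (K b n) := by omega
  have hK0 : K b n ≠ 0 := by
    intro h0
    have hsub : {v : ℕ | f b v = 0} ⊆ {0} := fun v hv => Nat.le_zero.1 (le_of_f_eq hv)
    have hcard := Set.ncard_le_ncard hsub
    rw [Set.ncard_singleton] at hcard
    rw [h0, F] at hK
    omega
  have hlow : b ^ B b n ≤ K b n := Nat.pow_log_le_self b hK0
  have hhigh : K b n < b ^ (B b n + 1) := Nat.lt_pow_succ_log_self (by omega) _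
  have hbpos : 0 < b ^ B b n := by positivity
  have hdiv : K b n / b ^ B b n * b ^ B b n + K b n % b ^ B b n = K b n := Nat.div_add_mod' _ _
  obtain ⟨hd, hr1, hr2⟩ := leading_digit_eq_one (b := b) (d := K b n / b ^ B b n) (m := B b n)
    (r := K b n % b ^ B b n) hb (Nat.div_pos hlow hbpos)
    (Nat.div_lt_of_lt_mul (by rwa [← pow_succ])) (Nat.mod_lt _ hbpos)
    (by rwa [hdiv]) (by rw [hdiv, hK]; exact hmin)
  rw [hd, one_mul] at hdiv
  refine ⟨?_, hd, K b n % b ^ B b n - 1, by omega, ?_, ?_⟩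
  · by_contra! h
    have h0 : B b n = 0 := by omega
    simp [h0] at hr2
  · zify [show 1 ≤ b by omega, hr1] at hr1 hr2 ⊢
    linarith
  · intro hodd
    obtain ⟨v, hv⟩ := exists_f_eq_of_F_pos hpos
    have hev : Even (K b n) := hv ▸ even_f hodd v
    have hop : Odd (b ^ B b n) := hodd.pow
    refine ⟨hev, ?_⟩
    rw [Nat.even_iff] at hev ⊢
    rw [Nat.odd_iff] at hop
    omega

end Kaprekar
end

section
/- For every integer base b ≥ 2, there exists u ∈ ℕ with F(u) = 2, and the least such u is K(2) = b² + 1 if b is even and K(2) = b + 1 if b is odd; consequently B(2) = 2 if b is even and B(2) = 1 if b is odd. -/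
namespace Kaprekar

theorem s_eq_mod_add {b : ℕ} (hb : 2 ≤ b) (v : ℕ) : s b v = v % b + s b (v / b) := by
  rcases Nat.eq_zero_or_pos v with rfl | hv
  · simp [s]
  · simp [s, Nat.digits_def' hb hv]

theorem s_of_lt_s9 {b v : ℕ} (hv : v < b) : s b v = v := by
  rcases Nat.eq_zero_or_pos v with rfl | h
  · simp [s]
  · simp [s, Nat.digits_of_lt b v h.ne' hv]

theorem s_pos {b v : ℕ} (hb : 2 ≤ b) (hv : 0 < v) : 0 < s b v := by
  induction v using Nat.strong_induction_on with
  | _ v ih =>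
    rcases lt_or_ge v b with h | h
    · rwa [s_of_lt_s9 h]
    · rw [s_eq_mod_add hb]
      have := ih (v / b) (Nat.div_lt_self hv hb) (Nat.div_pos h (by omega))
      omega

theorem s_pow {b : ℕ} (hb : 2 ≤ b) (k : ℕ) : s b (b ^ k) = 1 := by
  induction k with
  | zero => rw [pow_zero, s_of_lt_s9 hb]
  | succ k ih =>
    rw [s_eq_mod_add hb, pow_succ, Nat.mul_mod_left, Nat.mul_div_cancel _ (by omega), ih]

/-- For `d, e < b`, the number with digits `d` (leading) and `e` has `f`-value `d (b + 1) + 2 e`. -/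
theorem f_two_digits {b d e : ℕ} (hb : 2 ≤ b) (hd : d < b) (he : e < b) :
    f b (d * b + e) = d * (b + 1) + 2 * e := by
  have h1 : (d * b + e) % b = e := by
    rw [mul_comm, Nat.mul_add_mod, Nat.mod_eq_of_lt he]
  have h2 : (d * b + e) / b = d := by
    rw [mul_comm, Nat.mul_add_div (by omega), Nat.div_eq_of_lt he, add_zero]
  rw [f, s_eq_mod_add hb, h1, h2, s_of_lt_s9 hd]
  ring

theorem injOn_f_lt (b : ℕ) : Set.InjOn (f b) (Set.Iio b) := by
  intro v hv w hw h
  simp only [f, s_of_lt_s9 (Set.mem_Iio.1 hv), s_of_lt_s9 (Set.mem_Iio.1 hw)] at h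
  omega

theorem injOn_f_lt_sq {b : ℕ} (hb : 2 ≤ b) (he : Even b) :
    Set.InjOn (f b) (Set.Iio (b ^ 2)) := by
  intro v hv w hw h
  have hb0 : 0 < b := by omega
  rw [Set.mem_Iio, sq] at hv hw
  have hv1 := Nat.div_lt_of_lt_mul hv
  have hw1 := Nat.div_lt_of_lt_mul hw
  have hv0 := Nat.mod_lt v hb0
  have hw0 := Nat.mod_lt w hb0
  have ev := Nat.div_add_mod' v b
  have ew := Nat.div_add_mod' w b
  rw [← ev, ← ew, f_two_digits hb hv1 hv0, f_two_digits hb hw1 hw0] at h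
  rw [← ev, ← ew]
  generalize v / b = p at *
  generalize v % b = q at *
  generalize w / b = r at *
  generalize w % b = t at *
  have hz : ((p : ℤ) - r) * (b + 1) = 2 * (t - q) := by
    zify at h
    linarith
  have hcop : IsCoprime (2 : ℤ) (b + 1) := by
    obtain ⟨c, rfl⟩ := he
    exact ⟨-c, 1, by push_cast; ring⟩
  obtain ⟨k, hk⟩ := hcop.dvd_of_dvd_mul_right ⟨_, hz⟩
  have htq : (t : ℤ) - q = (b + 1) * k := by
    rw [hk] at hz
    linarith
  have h0 : (t : ℤ) - q = 0 :=
    Int.eq_zero_of_abs_lt_dvd ⟨k, htq⟩ (abs_lt.2 ⟨by omega, by omega⟩)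
  have hk0 : k = 0 := by
    rw [h0] at htq
    exact (mul_eq_zero.1 htq.symm).resolve_left (by omega)
  subst hk0
  rw [show p = r by omega, show q = t by omega]

/-- If `f` is injective below `b ^ k` and takes the value `b ^ k + 1 = f (b ^ k)` there, then
`b ^ k + 1` is the least number with two generators. -/
theorem isLeast_of_injOn {b k w : ℕ} (hb : 2 ≤ b) (hinj : Set.InjOn (f b) (Set.Iio (b ^ k)))
    (hw : w < b ^ k) (hfw : f b w = b ^ k + 1) :
    IsLeast {u : ℕ | F b u = 2} (b ^ k + 1) := by
  have hN : 0 < b ^ k := Nat.pow_pos (by omega)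
  have hlt : ∀ v, b ^ k < v → b ^ k + 1 < f b v := fun v hv => by
    have := s_pos hb (hN.trans hv)
    unfold f
    omega
  have hfN : f b (b ^ k) = b ^ k + 1 := by rw [f, s_pow hb]
  constructor
  · have : {v : ℕ | f b v = b ^ k + 1} = {w, b ^ k} := by
      ext v
      simp only [Set.mem_ofPred_eq, Set.mem_insert_iff, Set.mem_singleton_iff]
      constructor
      · intro hv
        rcases lt_trichotomy v (b ^ k) with h | h | h
        · exact Or.inl (hinj h hw (hv.trans hfw.symm))
        · exact Or.inr h
        · exact absurd hv (hlt v h).ne'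
      · rintro (rfl | rfl)
        exacts [hfw, hfN]
    rw [Set.mem_ofPred_eq, F, this, Set.ncard_pair hw.ne]
  · intro u hu
    by_contra! hlt_u
    have hmem : ∀ v, f b v = u → v < b ^ k := fun v hv => by
      rcases lt_trichotomy v (b ^ k) with h | h | h
      · exact h
      · subst h
        omega
      · have := hlt v h
        omega
    have hsub : {v : ℕ | f b v = u}.Subsingleton := fun x hx y hy =>
      hinj (hmem x hx) (hmem y hy) (hx.trans hy.symm)
    have h1 : F b u ≤ 1 := (Set.ncard_le_one hsub.finite).2 fun x hx y hy => hsub hx hy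
    rw [Set.mem_ofPred_eq] at hu
    omega

theorem B_two_eq {b k : ℕ} (hb : 2 ≤ b) (hk : k ≠ 0)
    (h : IsLeast {u : ℕ | F b u = 2} (b ^ k + 1)) : B b 2 = k := by
  rw [B, K, h.csInf_eq]
  apply Nat.log_eq_of_pow_le_of_lt_pow (Nat.le_succ _)
  have h1 : 1 < b ^ k := Nat.one_lt_pow hk hb
  rw [pow_succ]
  nlinarith

theorem stmt9 (b : ℕ) (hb : 2 ≤ b) :
    (Even b → IsLeast {u : ℕ | F b u = 2} (b ^ 2 + 1) ∧ B b 2 = 2) ∧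
    (Odd b → IsLeast {u : ℕ | F b u = 2} (b + 1) ∧ B b 2 = 1) := by
  constructor
  · intro he
    have h : IsLeast {u : ℕ | F b u = 2} (b ^ 2 + 1) := by
      obtain ⟨c, rfl⟩ : ∃ c, b = c + 1 := ⟨b - 1, by omega⟩
      refine isLeast_of_injOn (w := c * (c + 1) + 1) hb (injOn_f_lt_sq hb he) (by nlinarith) ?_
      rw [f_two_digits hb (by omega) (by omega)]
      ring
    exact ⟨h, B_two_eq hb two_ne_zero h⟩
  · rintro ⟨c, rfl⟩
    have h : IsLeast {u : ℕ | F (2 * c + 1) u = 2} ((2 * c + 1) ^ 1 + 1) := by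
      have hc : c + 1 < 2 * c + 1 := by omega
      refine isLeast_of_injOn (w := c + 1) hb ?_ (by rwa [pow_one]) ?_
      · rw [pow_one]
        exact injOn_f_lt _
      · rw [f, s_of_lt_s9 hc]
        ring
    exact ⟨by simpa only [pow_one] using h, B_two_eq hb one_ne_zero h⟩

end Kaprekar
end
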